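/- Let P be a simple convex polytope of dimension n ≥ 3 (every vertex lies in exactly n facets) with face numbers α_i = number of i-dimensional faces of P. Then the polynomial R(s) = α₀ + α₁(s−1) + α₂(s−1)² + ⋯ + α_{n−1}(s−1)^{n−1} + (s−1)^n satisfies the palindromic identity R(s) = s^n · R(1/s) (the Dehn–Sommerville relations). -/

import Mathlib

open Set Filter Topology

section Polytope

variable {E : Type*} [NormedAddCommGroup E] [NormedSpace ℝ E]

theorem mem_convexHull_filter_eq {s : Finset E} {l : StrongDual ℝ E} {M : ℝ}
    (hl : ∀ w ∈ s, l w ≤ M) {x : E} (hx : x ∈ convexHull ℝ (s : Set E)) (hxM : l x = M) :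
    x ∈ convexHull ℝ {w | w ∈ s ∧ l w = M} := by
  classical
  obtain ⟨c, hc0, hc1, hcx⟩ := Finset.mem_convexHull'.1 hx
  have hsum : ∑ w ∈ s, c w * (M - l w) = 0 := by
    have h : ∑ w ∈ s, c w * l w = M := by
      rw [← hxM, ← hcx, map_sum]
      simp
    simp only [mul_sub, Finset.sum_sub_distrib, ← Finset.sum_mul, hc1, h]
    ring
  have hzero := (Finset.sum_eq_zero_iff_of_nonneg
    fun w hw => mul_nonneg (hc0 w hw) (sub_nonneg.2 (hl w hw))).1 hsum
  have hsupp : ∀ w ∈ s, w ∉ s.filter (fun w => l w = M) → c w = 0 := fun w hw hw' => by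
    rcases mul_eq_zero.1 (hzero w hw) with h | h
    · exact h
    · exact absurd (Finset.mem_filter.2 ⟨hw, (sub_eq_zero.1 h).symm⟩) hw'
  have hset : {w | w ∈ s ∧ l w = M} = ((s.filter fun w => l w = M : Finset E) : Set E) := by
    ext; simp
  rw [hset, Finset.mem_convexHull']
  refine ⟨c, fun w hw => hc0 w (Finset.mem_filter.1 hw).1, ?_, ?_⟩
  · rw [← hc1]
    exact Finset.sum_subset (Finset.filter_subset _ _) hsupp
  · rw [← hcx]
    exact Finset.sum_subset (Finset.filter_subset _ _) fun w hw hw' => by simp [hsupp w hw hw']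

theorem le_of_mem_convexHull {s : Set E} {l : StrongDual ℝ E} {M : ℝ}
    (hl : ∀ w ∈ s, l w ≤ M) {x : E} (hx : x ∈ convexHull ℝ s) : l x ≤ M :=
  convexHull_min (t := {x | l x ≤ M}) hl (convex_halfSpace_le l.toLinearMap.isLinear M) hx

theorem IsExposed.eq_convexHull_inter {s : Finset E} {F : Set E}
    (hF : IsExposed ℝ (convexHull ℝ (s : Set E)) F) : F = convexHull ℝ ((s : Set E) ∩ F) := by
  rcases F.eq_empty_or_nonempty with rfl | hne
  · simp
  obtain ⟨l, hl⟩ := hF hne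
  apply Subset.antisymm
  · intro x hx
    have hx' := hx
    rw [hl] at hx'
    refine convexHull_mono ?_
      (mem_convexHull_filter_eq (fun w hw => hx'.2 w (subset_convexHull ℝ _ hw)) hx'.1 rfl)
    rintro w ⟨hw, hwx⟩
    refine ⟨hw, ?_⟩
    rw [hl]
    exact ⟨subset_convexHull ℝ _ hw, fun y hy => hwx ▸ hx'.2 y hy⟩
  · exact convexHull_min inter_subset_right (hF.convex (convex_convexHull ℝ _))

theorem finite_setOf_isExposed_convexHull (s : Finset E) :
    {F | IsExposed ℝ (convexHull ℝ (s : Set E)) F}.Finite := by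
  refine Set.Finite.subset (s.finite_toSet.finite_subsets.image (convexHull ℝ)) ?_
  intro F hF
  exact ⟨_, inter_subset_left, (IsExposed.eq_convexHull_inter hF).symm⟩

theorem finrank_direction_affineSpan_lt [FiniteDimensional ℝ E] {F : Set E} {l : StrongDual ℝ E}
    {M : ℝ} (hl : l ≠ 0) (hF : ∀ x ∈ F, l x = M) :
    Module.finrank ℝ (affineSpan ℝ F).direction < Module.finrank ℝ E := by
  apply Submodule.finrank_lt
  intro h
  apply hl
  have hle : (affineSpan ℝ F).direction ≤ LinearMap.ker l.toLinearMap := by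
    rw [direction_affineSpan, vectorSpan, Submodule.span_le]
    rintro _ ⟨x, hx, y, hy, rfl⟩
    simp [hF x hx, hF y hy]
  ext x
  have := hle (h ▸ Submodule.mem_top : x ∈ _)
  simpa using this

theorem IsOpen.exists_forall_notMem_affineSubspace [FiniteDimensional ℝ E] {U : Set E}
    (hU : IsOpen U) (hne : U.Nonempty) {A : Set (AffineSubspace ℝ E)} (hA : A.Finite)
    (htop : ⊤ ∉ A) : ∃ p ∈ U, ∀ Q ∈ A, p ∉ Q := by
  borelize E
  by_contra! h
  have hsub : U ⊆ ⋃ Q ∈ A, (Q : Set E) := fun p hp => by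
    obtain ⟨Q, hQ, hpQ⟩ := h p hp
    exact mem_biUnion hQ hpQ
  have hzero : MeasureTheory.Measure.addHaar (⋃ Q ∈ A, (Q : Set E)) = 0 :=
    (MeasureTheory.measure_biUnion_null_iff hA.countable).2 fun Q hQ =>
      MeasureTheory.Measure.addHaar_affineSubspace _ Q fun h => htop (h ▸ hQ)
  exact (hU.measure_pos MeasureTheory.Measure.addHaar hne).ne'
    (MeasureTheory.measure_mono_null hsub hzero)

/-- A point outside a full-dimensional polytope is cut off by some facet. -/
theorem exists_facet_forall_lt [FiniteDimensional ℝ E] {s : Finset E}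
    (hfull : (interior (convexHull ℝ (s : Set E))).Nonempty) {x : E}
    (hx : x ∉ convexHull ℝ (s : Set E)) :
    ∃ F, IsExposed ℝ (convexHull ℝ (s : Set E)) F ∧ F.Nonempty ∧
      Module.finrank ℝ (affineSpan ℝ F).direction = Module.finrank ℝ E - 1 ∧
      ∀ l : StrongDual ℝ E, F = l.toExposed (convexHull ℝ (s : Set E)) →
        ∀ y ∈ F, l y < l x := by
  set P := convexHull ℝ (s : Set E) with hP
  have hconv : Convex ℝ P := convex_convexHull ℝ _
  have hcomp : IsCompact P := s.finite_toSet.isCompact_convexHull ℝ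
  obtain ⟨p, hpint, hp⟩ := isOpen_interior.exists_forall_notMem_affineSubspace hfull
    (A := (fun T => affineSpan ℝ (insert x T)) '' {T | T ⊆ (s : Set E)} \ {⊤})
    ((s.finite_toSet.finite_subsets.image _).subset sdiff_subset) (fun h => h.2 rfl)
  have hpP : p ∈ P := interior_subset hpint
  let f : ℝ → E := fun t => AffineMap.lineMap p x t
  have hf : Continuous f := AffineMap.lineMap_continuous
  have hIcomp : IsCompact (Icc (0 : ℝ) 1 ∩ f ⁻¹' P) :=
    isCompact_Icc.inter_right (hcomp.isClosed.preimage hf)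
  obtain ⟨t, ⟨ht, htP⟩, htmax⟩ := hIcomp.exists_isGreatest ⟨0, by simp [f, hpP]⟩
  have ht1 : t < 1 := lt_of_le_of_ne ht.2 fun h => hx (by simpa [f, h] using htP)
  have hnint : f t ∉ interior P := fun h => by
    have h1 : ∀ᶠ r in 𝓝[>] t, f r ∈ P :=
      (hf.continuousAt.eventually (mem_interior_iff_mem_nhds.1 h)).filter_mono
        nhdsWithin_le_nhds
    obtain ⟨r, hrP, hr⟩ := (h1.and (Ioo_mem_nhdsGT ht1)).exists
    exact (htmax ⟨⟨ht.1.trans hr.1.le, hr.2.le⟩, hrP⟩).not_gt hr.1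
  obtain ⟨m, hm⟩ := geometric_hahn_banach_open_point hconv.interior isOpen_interior hnint
  have hmle : ∀ a ∈ P, m a ≤ m (f t) := by
    have hcl : P ⊆ closure (interior P) := by
      rw [hconv.closure_interior_eq_closure_of_nonempty_interior hfull]
      exact subset_closure
    exact fun a ha => closure_minimal (fun b hb => (hm b hb).le)
      (isClosed_le m.continuous continuous_const) (hcl ha)
  have hm0 : m ≠ 0 := fun h => by simpa [h] using hm p hpint
  have hF : m.toExposed P = {z ∈ P | m z = m (f t)} := by
    ext z
    exact ⟨fun hz => ⟨hz.1, (hmle z hz.1).antisymm (hz.2 _ htP)⟩,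
      fun hz => ⟨hz.1, fun y hy => hz.2 ▸ hmle y hy⟩⟩
  have hftF : f t ∈ m.toExposed P := ⟨htP, hmle⟩
  refine ⟨m.toExposed P, ContinuousLinearMap.toExposed.isExposed, ⟨_, hftF⟩, ?_, ?_⟩
  · have hlt : Module.finrank ℝ (affineSpan ℝ (m.toExposed P)).direction < Module.finrank ℝ E :=
      finrank_direction_affineSpan_lt hm0 (M := m (f t)) fun z hz => (hF ▸ hz : _ ∈ {z ∈ P | _}).2
    set T : Set E := {w | w ∈ s ∧ m w = m (f t)} with hT
    have hTF : T ⊆ m.toExposed P := fun w hw => hF ▸ ⟨subset_convexHull ℝ _ hw.1, hw.2⟩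
    have hfT : f t ∈ convexHull ℝ T :=
      mem_convexHull_filter_eq (fun w hw => hmle w (subset_convexHull ℝ _ hw)) htP rfl
    have hpmem : p ∈ affineSpan ℝ (insert x T) := by
      have h1 : f t ∈ affineSpan ℝ (insert x T) :=
        affineSpan_mono ℝ (subset_insert x T) (convexHull_subset_affineSpan T hfT)
      have h2 : x ∈ affineSpan ℝ (insert x T) := mem_affineSpan ℝ (mem_insert x T)
      have h3 : p = AffineMap.lineMap x (f t) (1 - t)⁻¹ := by
        have : (1 - t) ≠ 0 := by linarith
        have e : f t - x = (1 - t) • (p - x) := by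
          simp only [f, AffineMap.lineMap_apply_module]
          module
        rw [AffineMap.lineMap_apply, vsub_eq_sub, e, smul_smul, inv_mul_cancel₀ this]
        simp
      rw [h3]
      exact AffineMap.lineMap_mem _ h2 h1
    have htop : affineSpan ℝ (insert x T) = ⊤ := by
      by_contra h
      exact hp _ ⟨⟨T, fun w hw => hw.1, rfl⟩, h⟩ hpmem
    have h1 : Module.finrank ℝ E ≤ Module.finrank ℝ (vectorSpan ℝ T) + 1 := by
      have := finrank_vectorSpan_insert_le_set ℝ T x
      rwa [← direction_affineSpan ℝ (insert x T), htop, AffineSubspace.direction_top,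
        finrank_top] at this
    have h2 : Module.finrank ℝ (vectorSpan ℝ T) ≤
        Module.finrank ℝ (affineSpan ℝ (m.toExposed P)).direction := by
      rw [direction_affineSpan]
      exact Submodule.finrank_mono (vectorSpan_mono ℝ hTF)
    omega
  · intro l hl y hy
    have hyl : ∀ z ∈ P, l z ≤ l y := (hl ▸ hy : y ∈ l.toExposed P).2
    have hft : f t ∈ l.toExposed P := hl ▸ hftF
    have hfty : l (f t) = l y := (hyl _ htP).antisymm (hft.2 y (hl ▸ hy : y ∈ l.toExposed P).1)
    have hlp : l p < l y := by
      refine (hyl p hpP).lt_of_ne fun h => ?_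
      have : p ∈ m.toExposed P := by
        rw [hl]
        exact ⟨hpP, fun z hz => h ▸ hyl z hz⟩
      exact (hm p hpint).not_ge (this.2 _ htP)
    have e : l (f t) = (1 - t) * l p + t * l x := by
      simp [f, AffineMap.lineMap_apply_module]
    rcases ht.1.eq_or_lt with h | h
    · subst h
      simp only [sub_zero, one_mul, zero_mul, add_zero] at e
      linarith
    · nlinarith

theorem exists_pos_add_smul_mem [FiniteDimensional ℝ E] {s : Finset E}
    (hfull : (interior (convexHull ℝ (s : Set E))).Nonempty) {v d : E}
    (hv : v ∈ convexHull ℝ (s : Set E))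
    (h : ∀ F, IsExposed ℝ (convexHull ℝ (s : Set E)) F → v ∈ F →
      Module.finrank ℝ (affineSpan ℝ F).direction = Module.finrank ℝ E - 1 →
      ∃ l : StrongDual ℝ E, F = l.toExposed (convexHull ℝ (s : Set E)) ∧ l d ≤ 0) :
    ∃ ε > (0 : ℝ), v + ε • d ∈ convexHull ℝ (s : Set E) := by
  set P := convexHull ℝ (s : Set E)
  have hfin : {F | IsExposed ℝ P F ∧ F.Nonempty ∧
      Module.finrank ℝ (affineSpan ℝ F).direction = Module.finrank ℝ E - 1}.Finite :=
    (finite_setOf_isExposed_convexHull s).subset fun F hF => hF.1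
  have hev : ∀ᶠ ε in 𝓝[>] (0 : ℝ), ∀ F ∈ {F | IsExposed ℝ P F ∧ F.Nonempty ∧
      Module.finrank ℝ (affineSpan ℝ F).direction = Module.finrank ℝ E - 1},
      ∃ l : StrongDual ℝ E, F = l.toExposed P ∧ ∃ y ∈ F, l (v + ε • d) ≤ l y := by
    refine (eventually_all_finite hfin).2 fun F ⟨hF, hne, hdim⟩ => ?_
    by_cases hvF : v ∈ F
    · obtain ⟨l, hl, hld⟩ := h F hF hvF hdim
      filter_upwards [self_mem_nhdsWithin] with ε hε
      refine ⟨l, hl, v, hvF, ?_⟩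
      have := mul_nonpos_of_nonneg_of_nonpos (le_of_lt (mem_Ioi.1 hε)) hld
      simpa using this
    · obtain ⟨l, hl⟩ := hF hne
      obtain ⟨y, hy⟩ := hne
      have hy' : ∀ z ∈ P, l z ≤ l y := (hl ▸ hy : y ∈ {x ∈ P | ∀ y ∈ P, l y ≤ l x}).2
      have hlt : l v < l y := by
        refine (hy' v hv).lt_of_ne fun he => hvF ?_
        rw [hl]
        exact ⟨hv, fun z hz => he ▸ hy' z hz⟩
      have hcont : Continuous fun ε : ℝ => l (v + ε • d) := by fun_prop
      have : ∀ᶠ ε in 𝓝 (0 : ℝ), l (v + ε • d) < l y :=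
        hcont.continuousAt.eventually_lt continuousAt_const (by simpa using hlt)
      filter_upwards [this.filter_mono nhdsWithin_le_nhds] with ε hε
      exact ⟨l, hl, y, hy, hε.le⟩
  obtain ⟨ε, hε, hε0⟩ := (hev.and self_mem_nhdsWithin).exists
  refine ⟨ε, hε0, ?_⟩
  by_contra hmem
  obtain ⟨F, hF, hne, hdim, hlt⟩ := exists_facet_forall_lt hfull hmem
  obtain ⟨l, hl, y, hy, hle⟩ := hε F ⟨hF, hne, hdim⟩
  exact (hlt l hl y hy).not_ge hle

/-- A basis `e` spans the tangent cone of `P` at `v`. -/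
structure IsSimpleFrame {ι : Type*} (P : Set E) (v : E) (e : Module.Basis ι ℝ E) : Prop where
  repr_nonneg : ∀ x ∈ P, ∀ i, 0 ≤ e.repr (x - v) i
  exists_add_smul_mem : ∀ i, ∃ ε > (0 : ℝ), v + ε • e i ∈ P

theorem exists_isSimpleFrame [FiniteDimensional ℝ E] {s : Finset E}
    (hfull : (interior (convexHull ℝ (s : Set E))).Nonempty) {n : ℕ} (hn : 0 < n)
    (hE : Module.finrank ℝ E = n) {v : E} (hv : IsExposed ℝ (convexHull ℝ (s : Set E)) {v})
    (hsimple : Nat.card {F : Set E // IsExposed ℝ (convexHull ℝ (s : Set E)) F ∧ v ∈ F ∧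
      Module.finrank ℝ (affineSpan ℝ F).direction = n - 1} = n) :
    ∃ e : Module.Basis (Fin n) ℝ E, IsSimpleFrame (convexHull ℝ (s : Set E)) v e := by
  set P := convexHull ℝ (s : Set E)
  have hvP : v ∈ P := hv.subset rfl
  have : Finite {F : Set E // IsExposed ℝ P F ∧ v ∈ F ∧
      Module.finrank ℝ (affineSpan ℝ F).direction = n - 1} :=
    Nat.finite_of_card_ne_zero (by omega)
  let q := Finite.equivFinOfCardEq hsimple
  have hl : ∀ j, ∃ l : StrongDual ℝ E, (q.symm j).1 = l.toExposed P := fun j =>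
    (q.symm j).2.1 ⟨v, (q.symm j).2.2.1⟩
  choose l hl using hl
  have hmax : ∀ j, ∀ x ∈ P, l j x ≤ l j v := fun j x hx =>
    (hl j ▸ (q.symm j).2.2.1 : v ∈ (l j).toExposed P).2 x hx
  have hcone : ∀ d, (∀ j, l j d ≤ 0) → ∃ ε > (0 : ℝ), v + ε • d ∈ P := fun d hd => by
    refine exists_pos_add_smul_mem hfull hvP fun F hF hvF hdim => ?_
    obtain ⟨j, hj⟩ := q.symm.surjective ⟨F, hF, hvF, hE ▸ hdim⟩
    exact ⟨l j, by rw [← hl j, hj], hd j⟩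
  let L : E →ₗ[ℝ] (Fin n → ℝ) := LinearMap.pi fun j => -(l j).toLinearMap
  have hinj : Function.Injective L := by
    rw [← LinearMap.ker_eq_bot, LinearMap.ker_eq_bot']
    intro u hu
    have hu' : ∀ j, l j u = 0 := fun j => by
      have := congrFun hu j
      simpa [L] using this
    obtain ⟨ε, hε, hmem⟩ := hcone u fun j => (hu' j).le
    obtain ⟨δ, hδ, hmem'⟩ := hcone (-u) fun j => by simp [hu' j]
    obtain ⟨m, hm⟩ := hv ⟨v, rfl⟩
    have hmv : ∀ y ∈ P, m y ≤ m v := (hm ▸ rfl : v ∈ {x ∈ P | ∀ y ∈ P, m y ≤ m x}).2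
    have h1 := hmv _ hmem
    have h2 := hmv _ hmem'
    simp only [map_add, map_smul, map_neg, smul_eq_mul] at h1 h2
    have hmu : m u = 0 := le_antisymm
      (nonpos_of_mul_nonpos_right (by linarith) hε)
      (neg_nonpos.1 (nonpos_of_mul_nonpos_right (by linarith) hδ))
    have : v + ε • u ∈ ({v} : Set E) := by
      rw [hm]
      exact ⟨hmem, fun y hy => by simpa [hmu] using hmv y hy⟩
    simpa [hε.ne'] using this
  let e : Module.Basis (Fin n) ℝ E :=
    Module.Basis.ofEquivFun (LinearEquiv.ofInjectiveOfFinrankEq L hinj (by simp [hE]))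
  have hrepr : ∀ x j, e.repr x j = -l j x := fun x j => by
    rw [← Module.Basis.equivFun_apply, Module.Basis.equivFun_ofEquivFun]
    rfl
  refine ⟨e, fun x hx j => ?_, fun i => hcone _ fun j => ?_⟩
  · rw [hrepr, map_sub]
    linarith [hmax j x hx]
  · have := hrepr (e i) j
    rw [Module.Basis.repr_self, Finsupp.single_apply] at this
    split_ifs at this <;> linarith

/-- The face at `v` along the edge directions indexed by `S`. -/
def coordFace {ι : Type*} (P : Set E) (v : E) (e : Module.Basis ι ℝ E) (S : Finset ι) : Set E :=
  {x ∈ P | ∀ i, i ∉ S → e.repr (x - v) i = 0}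

namespace IsSimpleFrame

variable {ι : Type*} {P : Set E} {v : E} {e : Module.Basis ι ℝ E}

theorem add_smul_mem_coordFace_iff {ε : ℝ} (hε : 0 < ε) {i : ι} (hmem : v + ε • e i ∈ P)
    {S : Finset ι} : v + ε • e i ∈ coordFace P v e S ↔ i ∈ S := by
  classical
  simp only [coordFace, mem_ofPred_eq, hmem, true_and, add_sub_cancel_left, map_smul,
    Module.Basis.repr_self, Finsupp.smul_single, smul_eq_mul, mul_one, Finsupp.single_apply]
  constructor
  · intro h
    by_contra hi
    simpa [hε.ne'] using h i hi
  · rintro hi j hj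
    rw [if_neg]
    rintro rfl
    exact hj hi

theorem coordFace_injective (h : IsSimpleFrame P v e) : Function.Injective (coordFace P v e) := by
  intro S T hST
  ext i
  obtain ⟨ε, hε, hmem⟩ := h.exists_add_smul_mem i
  rw [← add_smul_mem_coordFace_iff hε hmem, ← add_smul_mem_coordFace_iff hε hmem, hST]

theorem mem_coordFace (hv : v ∈ P) (S : Finset ι) : v ∈ coordFace P v e S :=
  ⟨hv, by simp⟩

theorem finrank_direction_coordFace (h : IsSimpleFrame P v e) (hv : v ∈ P) (S : Finset ι) :
    Module.finrank ℝ (affineSpan ℝ (coordFace P v e S)).direction = S.card := by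
  classical
  have hdir : (affineSpan ℝ (coordFace P v e S)).direction = Submodule.span ℝ (e '' S) := by
    rw [direction_affineSpan, vectorSpan_eq_span_vsub_set_right ℝ (mem_coordFace hv S)]
    apply le_antisymm
    · rw [Submodule.span_le]
      rintro _ ⟨x, hx, rfl⟩
      rw [SetLike.mem_coe, Module.Basis.mem_span_image]
      intro i hi
      by_contra hiS
      exact Finsupp.mem_support_iff.1 hi (hx.2 i hiS)
    · rw [Submodule.span_le]
      rintro _ ⟨i, hi, rfl⟩
      obtain ⟨ε, hε, hmem⟩ := h.exists_add_smul_mem i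
      have hmem' := Submodule.smul_mem _ ε⁻¹ (Submodule.subset_span (R := ℝ)
        (mem_image_of_mem (· -ᵥ v) ((add_smul_mem_coordFace_iff hε hmem).2 hi)))
      simpa [smul_smul, hε.ne'] using hmem'
  have hcard := finrank_span_finset_eq_card (R := ℝ) (s := S.image e) (by
    rw [Finset.coe_image]
    exact (e.linearIndependent.linearIndepOn (s := (S : Set ι))).id_image)
  rw [hdir, ← Finset.coe_image, hcard, Finset.card_image_of_injective _ e.injective]

variable [Fintype ι]

theorem apply_eq_add_sum (e : Module.Basis ι ℝ E) (v : E) (l : StrongDual ℝ E) (x : E) :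
    l x = l v + ∑ i, e.repr (x - v) i * l (e i) := by
  have h := congrArg l (e.sum_repr (x - v))
  simp only [map_sum, map_smul, map_sub l, smul_eq_mul] at h
  rw [h]
  ring

theorem isExposed_coordFace (h : IsSimpleFrame P v e) (hv : v ∈ P) (S : Finset ι) :
    IsExposed ℝ P (coordFace P v e S) := by
  classical
  have : FiniteDimensional ℝ E := e.finiteDimensional_of_finite
  let l : StrongDual ℝ E := LinearMap.toContinuousLinearMap (-∑ i ∈ Sᶜ, e.coord i)
  have hl : ∀ x, l x = l v - ∑ i ∈ Sᶜ, e.repr (x - v) i := fun x => by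
    simp only [l, LinearMap.coe_toContinuousLinearMap', LinearMap.neg_apply, LinearMap.sum_apply,
      Module.Basis.coord_apply, map_sub, Finsupp.sub_apply, Finset.sum_sub_distrib]
    ring
  refine fun _ => ⟨l, Subset.antisymm ?_ ?_⟩
  · rintro x ⟨hx, hxS⟩
    refine ⟨hx, fun y hy => ?_⟩
    rw [hl x, hl y, Finset.sum_eq_zero fun i hi => hxS i (Finset.mem_compl.1 hi)]
    have := Finset.sum_nonneg fun i (_ : i ∈ Sᶜ) => h.repr_nonneg y hy i
    linarith
  · rintro x ⟨hx, hxl⟩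
    have hle := hxl v hv
    rw [hl x] at hle
    have hnn := fun i (_ : i ∈ Sᶜ) => h.repr_nonneg x hx i
    have hz := (Finset.sum_eq_zero_iff_of_nonneg hnn).1
      (le_antisymm (by linarith) (Finset.sum_nonneg hnn))
    exact ⟨hx, fun i hi => hz i (Finset.mem_compl.2 hi)⟩

theorem exists_eq_coordFace (h : IsSimpleFrame P v e) {F : Set E} (hF : IsExposed ℝ P F)
    (hv : v ∈ F) : ∃ S, F = coordFace P v e S := by
  classical
  obtain ⟨l, hl⟩ := hF ⟨v, hv⟩
  have hvl : ∀ y ∈ P, l y ≤ l v := (hl ▸ hv : v ∈ {x ∈ P | ∀ y ∈ P, l y ≤ l x}).2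
  have hle : ∀ i, l (e i) ≤ 0 := fun i => by
    obtain ⟨ε, hε, hmem⟩ := h.exists_add_smul_mem i
    have := hvl _ hmem
    simp only [map_add, map_smul, smul_eq_mul] at this
    exact nonpos_of_mul_nonpos_right (by linarith) hε
  refine ⟨Finset.univ.filter fun i => l (e i) = 0, ?_⟩
  rw [hl]
  apply Subset.antisymm
  · rintro x ⟨hx, hxl⟩
    refine ⟨hx, fun i hi => ?_⟩
    have hle' := hxl v (hF.subset hv)
    rw [apply_eq_add_sum e v l x] at hle'
    have hnp := fun i (_ : i ∈ Finset.univ) =>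
      mul_nonpos_of_nonneg_of_nonpos (h.repr_nonneg x hx i) (hle i)
    have hz := (Finset.sum_eq_zero_iff_of_nonpos hnp).1
      (le_antisymm (Finset.sum_nonpos hnp) (by linarith)) i (Finset.mem_univ i)
    exact (mul_eq_zero.1 hz).resolve_right fun h0 => hi (by simp [h0])
  · rintro x ⟨hx, hxS⟩
    refine ⟨hx, fun y hy => ?_⟩
    rw [apply_eq_add_sum e v l x, Finset.sum_eq_zero, add_zero]
    · exact hvl y hy
    · intro i _
      by_cases hi : l (e i) = 0
      · simp [hi]
      · rw [hxS i (by simpa using hi), zero_mul]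

theorem forall_mem_coordFace_le_iff (h : IsSimpleFrame P v e) (φ : StrongDual ℝ E)
    (S : Finset ι) : (∀ x ∈ coordFace P v e S, φ v ≤ φ x) ↔ ∀ i ∈ S, 0 ≤ φ (e i) := by
  constructor
  · intro hmin i hi
    obtain ⟨ε, hε, hmem⟩ := h.exists_add_smul_mem i
    have := hmin _ ((add_smul_mem_coordFace_iff hε hmem).2 hi)
    simp only [map_add, map_smul, smul_eq_mul] at this
    exact nonneg_of_mul_nonneg_right (by linarith) hε
  · rintro hS x ⟨hx, hxS⟩
    rw [apply_eq_add_sum e v φ x]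
    refine le_add_of_nonneg_right (Finset.sum_nonneg fun i _ => ?_)
    by_cases hi : i ∈ S
    · exact mul_nonneg (h.repr_nonneg x hx i) (hS i hi)
    · rw [hxS i hi, zero_mul]

end IsSimpleFrame

theorem IsExposed.exists_vertex_forall_lt {s : Finset E} {F : Set E}
    (hF : IsExposed ℝ (convexHull ℝ (s : Set E)) F) (hne : F.Nonempty) {φ : StrongDual ℝ E}
    (hφ : InjOn φ s) :
    ∃ v ∈ F, IsExposed ℝ (convexHull ℝ (s : Set E)) {v} ∧ ∀ x ∈ F, x ≠ v → φ v < φ x := by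
  classical
  set P := convexHull ℝ (s : Set E)
  have hconv := IsExposed.eq_convexHull_inter hF
  have hsne : ((s : Set E) ∩ F).Nonempty := by
    rw [hconv] at hne
    exact convexHull_nonempty_iff.1 hne
  obtain ⟨v, ⟨hvs, hvF⟩, hmin⟩ :=
    exists_min_image _ φ (s.finite_toSet.subset inter_subset_left) hsne
  have hminF : ∀ w ∈ s, w ∈ F → w ≠ v → φ v < φ w := fun w hw hwF hwv =>
    (hmin w ⟨hw, hwF⟩).lt_of_ne fun h => hwv (hφ hw hvs h.symm)
  have key : ∀ (m : StrongDual ℝ E) (A : Finset E), (∀ w ∈ A, w ≠ v → m w < m v) →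
      ∀ x ∈ convexHull ℝ (A : Set E), m v ≤ m x → x = v := fun m A hm x hx hle => by
    have hmA : ∀ w ∈ A, m w ≤ m v := fun w hw => by
      rcases eq_or_ne w v with rfl | hwv
      · exact le_rfl
      · exact (hm w hw hwv).le
    have hx' := mem_convexHull_filter_eq hmA hx ((le_of_mem_convexHull hmA hx).antisymm hle)
    have hsub : {w | w ∈ A ∧ m w = m v} ⊆ {v} := fun w hw => by
      by_contra hwv
      exact (hm w hw.1 hwv).ne hw.2
    simpa using convexHull_mono hsub hx'
  obtain ⟨l, hl⟩ := hF hne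
  have hlv : ∀ y ∈ P, l y ≤ l v := (hl ▸ hvF : v ∈ {x ∈ P | ∀ y ∈ P, l y ≤ l x}).2
  refine ⟨v, hvF, ?_, ?_⟩
  · have hev : ∀ᶠ ε in 𝓝[>] (0 : ℝ), ∀ w ∈ s, w ≠ v → (l - ε • φ) w < (l - ε • φ) v := by
      refine (Finset.eventually_all s).2 fun w hw => ?_
      by_cases hwF : w ∈ F
      · filter_upwards [self_mem_nhdsWithin] with ε hε hwv
        have h1 := hlv w (hF.subset hwF)
        have h2 := mul_lt_mul_of_pos_left (hminF w hw hwF hwv) (mem_Ioi.1 hε)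
        simp only [sub_apply, smul_apply, smul_eq_mul]
        linarith
      · have hwP : w ∈ P := subset_convexHull ℝ _ hw
        have hlt : l w < l v := (hlv w hwP).lt_of_ne fun h => hwF (by
          rw [hl]
          exact ⟨hwP, fun y hy => h ▸ hlv y hy⟩)
        have hc : ∀ x, ContinuousAt (fun ε : ℝ => (l - ε • φ) x) 0 := fun x => by
          simp only [sub_apply, smul_apply]
          fun_prop
        have : ∀ᶠ ε in 𝓝 (0 : ℝ), (l - ε • φ) w < (l - ε • φ) v :=
          (hc w).eventually_lt (hc v) (by simpa using hlt)
        filter_upwards [this.filter_mono nhdsWithin_le_nhds] with ε hε _ using hε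
    obtain ⟨ε, hε⟩ := hev.exists
    refine fun _ => ⟨l - ε • φ, Subset.antisymm ?_ fun x hx => ?_⟩
    · rw [singleton_subset_iff]
      refine ⟨hF.subset hvF, fun y hy => le_of_mem_convexHull (fun w hw => ?_) hy⟩
      rcases eq_or_ne w v with rfl | hwv
      · exact le_rfl
      · exact (hε w hw hwv).le
    · exact key _ s hε x hx.1 (hx.2 v (hF.subset hvF))
  · intro x hx hxv
    by_contra! hle
    refine hxv (key (-φ) (s.filter (· ∈ F)) (fun w hw hwv => ?_) x ?_ (by simpa using hle))
    · obtain ⟨hw, hwF⟩ := Finset.mem_filter.1 hw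
      simpa using hminF w hw hwF hwv
    · rw [hconv] at hx
      convert! hx using 2
      ext; simp
theorem IsSimpleFrame.apply_ne_zero {s : Finset E} {ι : Type*} [Fintype ι] {v : E}
    {e : Module.Basis ι ℝ E} (h : IsSimpleFrame (convexHull ℝ (s : Set E)) v e)
    (hv : v ∈ convexHull ℝ (s : Set E)) {φ : StrongDual ℝ E} (hφ : InjOn φ s) (i : ι) :
    φ (e i) ≠ 0 := by
  intro h0
  obtain ⟨ε, hε, hmem⟩ := h.exists_add_smul_mem i
  have hmem' := (IsSimpleFrame.add_smul_mem_coordFace_iff hε hmem).2 (Finset.mem_singleton_self i)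
  have hvmem := IsSimpleFrame.mem_coordFace (e := e) hv {i}
  obtain ⟨w, hw, -, hlt⟩ :=
    (h.isExposed_coordFace hv {i}).exists_vertex_forall_lt ⟨v, hvmem⟩ hφ
  have hle := (h.forall_mem_coordFace_le_iff φ {i}).2 (by simp [h0]) w hw
  have hvw : v = w := by
    by_contra hvw
    exact (hlt v hvmem hvw).not_ge hle
  subst hvw
  exact (hlt _ hmem' (by simp [hε.ne', e.ne_zero i])).ne (by simp [h0])

/-- Summing over faces according to the vertex where a generic functional is minimal. -/
theorem sum_pow_finrank_direction_eq {s : Finset E} {ι : Type*} [Fintype ι]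
    {V : Finset E} (hV : ∀ v, v ∈ V ↔ IsExposed ℝ (convexHull ℝ (s : Set E)) {v})
    {e : E → Module.Basis ι ℝ E}
    (he : ∀ v ∈ V, IsSimpleFrame (convexHull ℝ (s : Set E)) v (e v))
    {𝓕 : Finset (Set E)}
    (h𝓕 : ∀ F, F ∈ 𝓕 ↔ IsExposed ℝ (convexHull ℝ (s : Set E)) F ∧ F.Nonempty)
    {φ : StrongDual ℝ E} (hφ : InjOn φ s) (t : ℝ) :
    ∑ F ∈ 𝓕, t ^ Module.finrank ℝ (affineSpan ℝ F).direction =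
      ∑ v ∈ V, (1 + t) ^ (Finset.univ.filter fun i => 0 < φ (e v i)).card := by
  classical
  set P := convexHull ℝ (s : Set E)
  have hVP : ∀ v ∈ V, v ∈ P := fun v hv => ((hV v).1 hv).subset rfl
  have hmin : ∀ F, ∃ v, F ∈ 𝓕 → v ∈ F ∧ v ∈ V ∧ ∀ x ∈ F, x ≠ v → φ v < φ x := fun F => by
    by_cases hF : F ∈ 𝓕
    · obtain ⟨hF, hne⟩ := (h𝓕 F).1 hF
      obtain ⟨v, h1, h2, h3⟩ := IsExposed.exists_vertex_forall_lt hF hne hφ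
      exact ⟨v, fun _ => ⟨h1, (hV v).2 h2, h3⟩⟩
    · exact ⟨0, fun h => absurd h hF⟩
  choose g hg using hmin
  rw [← Finset.sum_fiberwise_of_maps_to (g := g) fun F hF => (hg F hF).2.1]
  refine Finset.sum_congr rfl fun v hv => ?_
  have hvP := hVP v hv
  have hfiber : 𝓕.filter (fun F => g F = v) =
      (Finset.univ.filter fun i => 0 < φ (e v i)).powerset.image (coordFace P v (e v)) := by
    ext F
    simp only [Finset.mem_filter, Finset.mem_image, Finset.mem_powerset]
    constructor
    · rintro ⟨hF, rfl⟩
      obtain ⟨hgF, -, hlt⟩ := hg F hF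
      obtain ⟨S, hS⟩ := (he _ hv).exists_eq_coordFace ((h𝓕 F).1 hF).1 hgF
      refine ⟨S, fun i hi => ?_, hS.symm⟩
      have hle : ∀ x ∈ coordFace P (g F) (e (g F)) S, φ (g F) ≤ φ x := fun x hx => by
        rcases eq_or_ne x (g F) with h | h
        · rw [h]
        · exact (hlt x (hS ▸ hx) h).le
      have h0 := ((he _ hv).forall_mem_coordFace_le_iff φ S).1 hle i hi
      simpa using h0.lt_of_ne' ((he _ hv).apply_ne_zero hvP hφ i)
    · rintro ⟨S, hS, rfl⟩
      have hF : coordFace P v (e v) S ∈ 𝓕 :=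
        (h𝓕 _).2 ⟨(he v hv).isExposed_coordFace hvP S, v, IsSimpleFrame.mem_coordFace hvP S⟩
      refine ⟨hF, ?_⟩
      obtain ⟨hgF, -, hlt⟩ := hg _ hF
      by_contra hne
      exact (hlt v (IsSimpleFrame.mem_coordFace hvP S) (Ne.symm hne)).not_ge
        (((he v hv).forall_mem_coordFace_le_iff φ S).2
          (fun i hi => (Finset.mem_filter.1 (hS hi)).2.le) _ hgF)
  rw [hfiber, Finset.sum_image (he v hv).coordFace_injective.injOn, add_comm,
    ← Finset.sum_pow_mul_eq_add_pow]
  exact Finset.sum_congr rfl fun S _ => by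
    rw [(he v hv).finrank_direction_coordFace hvP]
    simp

theorem exists_injOn_strongDual [FiniteDimensional ℝ E] (s : Finset E) :
    ∃ φ : StrongDual ℝ E, InjOn φ s := by
  obtain ⟨f, hf⟩ := Module.exists_dual_forall_apply_ne_zero (K := ℝ)
    (fun p : {p : s × s // p.1 ≠ p.2} => (p.1.1 : E) - p.1.2)
    fun p => sub_ne_zero.2 fun h => p.2 (Subtype.ext h)
  refine ⟨LinearMap.toContinuousLinearMap f, fun a ha b hb hab => ?_⟩
  by_contra hne
  refine hf ⟨(⟨a, ha⟩, ⟨b, hb⟩), fun h => hne (congrArg Subtype.val h)⟩ ?_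
  rw [map_sub]
  exact sub_eq_zero.2 hab

theorem sum_card_faces_mul_pow [FiniteDimensional ℝ E] {P : Set E} {n : ℕ}
    (hE : Module.finrank ℝ E = n) (hfull : (interior P).Nonempty) {α : ℕ → ℕ}
    (hα : ∀ i, α i = Nat.card {F : Set E // IsExposed ℝ P F ∧ F.Nonempty ∧ F ≠ P ∧
      Module.finrank ℝ (affineSpan ℝ F).direction = i})
    {𝓕 : Finset (Set E)} (h𝓕 : ∀ F, F ∈ 𝓕 ↔ IsExposed ℝ P F ∧ F.Nonempty) (t : ℝ) :
    (∑ i ∈ Finset.range n, (α i : ℝ) * t ^ i) + t ^ n =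
      ∑ F ∈ 𝓕, t ^ Module.finrank ℝ (affineSpan ℝ F).direction := by
  classical
  have hP : P ∈ 𝓕 := (h𝓕 P).2 ⟨IsExposed.refl P, hfull.mono interior_subset⟩
  have hdimP : Module.finrank ℝ (affineSpan ℝ P).direction = n := by
    have : affineSpan ℝ P = ⊤ :=
      top_unique (isOpen_interior.affineSpan_eq_top hfull ▸ affineSpan_mono _ interior_subset)
    rw [this, AffineSubspace.direction_top, finrank_top, hE]
  have hlt : ∀ F ∈ 𝓕.erase P,
      Module.finrank ℝ (affineSpan ℝ F).direction ∈ Finset.range n := fun F hF => by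
    obtain ⟨hne, hF⟩ := Finset.mem_erase.1 hF
    obtain ⟨hexp, x, hx⟩ := (h𝓕 F).1 hF
    obtain ⟨l, rfl⟩ := hexp ⟨x, hx⟩
    rw [Finset.mem_range, ← hE]
    refine finrank_direction_affineSpan_lt (l := l) (M := l x) ?_
      fun z hz => (hx.2 z hz.1).antisymm (hz.2 x hx.1)
    rintro rfl
    exact hne (by simp)
  rw [← Finset.sum_erase_add _ _ hP, hdimP, ← Finset.sum_fiberwise_of_maps_to hlt]
  congr 1
  refine Finset.sum_congr rfl fun i _ => ?_
  rw [Finset.sum_congr rfl fun F hF => by rw [(Finset.mem_filter.1 hF).2], Finset.sum_const,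
    nsmul_eq_mul, hα i]
  congr 2
  rw [← Nat.card_eq_finsetCard]
  exact Nat.card_congr (Equiv.subtypeEquivRight fun F => by
    simp only [Finset.mem_filter, Finset.mem_erase, h𝓕]
    tauto)

end Polytope

theorem dehn_sommerville (n : ℕ) (hn : 3 ≤ n)
    (P : Set (EuclideanSpace ℝ (Fin n)))
    (hpoly : ∃ s : Finset (EuclideanSpace ℝ (Fin n)), P = convexHull ℝ ↑s)
    (hfull : (interior P).Nonempty)
    (α : ℕ → ℕ)
    (hα : ∀ i, α i = Nat.card
      {F : Set (EuclideanSpace ℝ (Fin n)) //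
        IsExposed ℝ P F ∧ F.Nonempty ∧ F ≠ P ∧
        Module.finrank ℝ (affineSpan ℝ F).direction = i})
    (hsimple : ∀ v : EuclideanSpace ℝ (Fin n), IsExposed ℝ P {v} →
      Nat.card {F : Set (EuclideanSpace ℝ (Fin n)) //
        IsExposed ℝ P F ∧ v ∈ F ∧
        Module.finrank ℝ (affineSpan ℝ F).direction = n - 1} = n) :
    ∀ s : ℝ, s ≠ 0 →
      (∑ i ∈ Finset.range n, (α i : ℝ) * (s - 1) ^ i) + (s - 1) ^ n =
        s ^ n * ((∑ i ∈ Finset.range n, (α i : ℝ) * (1 / s - 1) ^ i) +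
          (1 / s - 1) ^ n) := by
  classical
  intro r hr
  obtain ⟨s, rfl⟩ := hpoly
  have hE : Module.finrank ℝ (EuclideanSpace ℝ (Fin n)) = n := finrank_euclideanSpace_fin
  have hfin := finite_setOf_isExposed_convexHull s
  have hfinF : {F | IsExposed ℝ (convexHull ℝ (s : Set (EuclideanSpace ℝ (Fin n)))) F ∧
      F.Nonempty}.Finite := hfin.subset fun F hF => hF.1
  have hfinV : {v | IsExposed ℝ (convexHull ℝ (s : Set (EuclideanSpace ℝ (Fin n)))) {v}}.Finite :=
    hfin.preimage Set.singleton_injective.injOn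
  have hframe : ∀ v, ∃ e : Module.Basis (Fin n) ℝ (EuclideanSpace ℝ (Fin n)),
      v ∈ hfinV.toFinset → IsSimpleFrame (convexHull ℝ (s : Set _)) v e := fun v => by
    by_cases hv : v ∈ hfinV.toFinset
    · have hv' := hfinV.mem_toFinset.1 hv
      obtain ⟨e, he⟩ := exists_isSimpleFrame hfull (by omega) hE hv' (hsimple v hv')
      exact ⟨e, fun _ => he⟩
    · exact ⟨Module.finBasisOfFinrankEq ℝ _ hE, fun h => absurd h hv⟩
  choose e he using hframe
  obtain ⟨φ, hφ⟩ := exists_injOn_strongDual s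
  have hφ' : InjOn (-φ) s := fun a ha b hb h => hφ ha hb (by simpa using h)
  have hV : ∀ v, v ∈ hfinV.toFinset ↔ _ := fun v => hfinV.mem_toFinset
  have hF : ∀ F, F ∈ hfinF.toFinset ↔ _ := fun F => hfinF.mem_toFinset
  rw [sum_card_faces_mul_pow hE hfull hα hF, sum_card_faces_mul_pow hE hfull hα hF,
    sum_pow_finrank_direction_eq hV he hF hφ, sum_pow_finrank_direction_eq hV he hF hφ',
    Finset.mul_sum]
  refine Finset.sum_congr rfl fun v hv => ?_
  have hcompl : (Finset.univ.filter fun i => 0 < (-φ) (e v i)) =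
      (Finset.univ.filter fun i => 0 < φ (e v i))ᶜ := by
    ext i
    have h0 := (he v hv).apply_ne_zero (((hV v).1 hv).subset rfl) hφ i
    simp only [Finset.mem_filter, Finset.mem_univ, true_and, Finset.mem_compl, neg_apply,
      Left.neg_pos_iff, not_lt]
    exact ⟨le_of_lt, fun h => h.lt_of_ne h0⟩
  have hcard := Finset.card_add_card_compl (Finset.univ.filter fun i => 0 < φ (e v i))
  rw [Fintype.card_fin] at hcard
  have hpow : r ^ n = _ := congrArg (r ^ ·) hcard.symm
  rw [hcompl, add_sub_cancel, add_sub_cancel, hpow, pow_add, one_div, inv_pow, mul_assoc,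
    mul_inv_cancel₀ (pow_ne_zero _ hr), mul_one]
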